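/- Let m, n be coprime positive integers with m ≥ 2, n/m > 1, and n dividing (m−1)². For every integer k ≥ 4, there is no k-stair packing polynomial on S(n/m). -/

import Mathlib

/-- The set of lattice points `I(n/m)` of the sector
`S(n/m) = {(x,y) : x ≥ 0, y ≥ 0, y ≤ (n/m)·x}`, described by `m·y ≤ n·x`. -/
def sectorLattice (n m : ℤ) : Set (ℤ × ℤ) :=
  {P : ℤ × ℤ | 0 ≤ P.1 ∧ 0 ≤ P.2 ∧ m * P.2 ≤ n * P.1}

/-- The sector `S(n/m)` in the real plane. -/
def sectorR (n m : ℤ) : Set (ℝ × ℝ) :=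
  {P : ℝ × ℝ | 0 ≤ P.1 ∧ 0 ≤ P.2 ∧ (m : ℝ) * P.2 ≤ (n : ℝ) * P.1}

/-- `p` is a packing polynomial on the region whose lattice points are `I`:
the restriction of `p` to `I` is a bijection from `I` onto `ℕ`. -/
def IsPackingPolyOn (p : ℝ → ℝ → ℝ) (I : Set (ℤ × ℤ)) : Prop :=
  (∀ P ∈ I, ∃ j : ℕ, p P.1 P.2 = j) ∧
  Set.InjOn (fun P : ℤ × ℤ => p P.1 P.2) I ∧
  (∀ j : ℕ, ∃ P ∈ I, p P.1 P.2 = j)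

/-- The `c`-th staircase `S_c` of `I(n/m)`: lattice points of the sector on the line
`y = (n/(m−1))·x − c·l/(m−1)`, i.e. `(m−1)·y = n·x − c·l`, where `l = gcd(n, m−1)`. -/
def staircase (n m : ℤ) (c : ℕ) : Set (ℤ × ℤ) :=
  {P : ℤ × ℤ | P ∈ sectorLattice n m ∧
    (m - 1) * P.2 = n * P.1 - (c : ℤ) * (Int.gcd n (m - 1) : ℤ)}

/-- Two stairs `r`, `s` are consecutive: they lie on a common staircase, are distinct,
and no stair of that staircase lies strictly between them on the segment from `r` to `s`. -/
def ConsecutiveStairs (n m : ℤ) (r s : ℤ × ℤ) : Prop :=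
  ∃ c : ℕ, r ∈ staircase n m c ∧ s ∈ staircase n m c ∧ r ≠ s ∧
    ∀ t ∈ staircase n m c, ¬(min r.1 s.1 < t.1 ∧ t.1 < max r.1 s.1)

/-- `P` is the first stair on the `c`-th staircase: the stair with minimal `x`-coordinate. -/
def IsFirstStair (n m : ℤ) (c : ℕ) (P : ℤ × ℤ) : Prop :=
  P ∈ staircase n m c ∧ ∀ Q ∈ staircase n m c, P.1 ≤ Q.1

/-- `p` is a quadratic polynomial whose homogeneous quadratic part is
`(n/2)·(x − ((m−1)/n)·y)²`. -/
def HasQuadPart (n m : ℤ) (p : ℝ → ℝ → ℝ) : Prop :=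
  ∃ d e f : ℝ, ∀ x y : ℝ,
    p x y = (n : ℝ) / 2 * (x - ((m : ℝ) - 1) / (n : ℝ) * y) ^ 2 + d * x + e * y + f

/-- `p(ℤ²) ⊆ ℤ`. -/
def IntValued (p : ℝ → ℝ → ℝ) : Prop :=
  ∀ a b : ℤ, ∃ z : ℤ, p a b = z

/-- `p` is a `k`-stair polynomial on `S(n/m)`: a quadratic polynomial with quadratic part
`(n/2)(x − ((m−1)/n)y)²`, integer-valued on `ℤ²`, whose values at consecutive stairs
differ by `±k`. -/
def IsKStair (n m : ℤ) (k : ℕ) (p : ℝ → ℝ → ℝ) : Prop :=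
  HasQuadPart n m p ∧ IntValued p ∧
  ∀ r s : ℤ × ℤ, ConsecutiveStairs n m r s →
    p r.1 r.2 - p s.1 s.2 = (k : ℝ) ∨ p r.1 r.2 - p s.1 s.2 = -(k : ℝ)

/-- An ascending `k`-stair polynomial: for consecutive stairs `r`, `s` with `|r| < |s|`,
`p(s) − p(r) = k`. -/
def IsAscendingKStair (n m : ℤ) (k : ℕ) (p : ℝ → ℝ → ℝ) : Prop :=
  IsKStair n m k p ∧
  ∀ r s : ℤ × ℤ, ConsecutiveStairs n m r s →
    r.1 ^ 2 + r.2 ^ 2 < s.1 ^ 2 + s.2 ^ 2 → p s.1 s.2 - p r.1 r.2 = (k : ℝ)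

/-- A descending `k`-stair polynomial: for consecutive stairs `r`, `s` with `|r| < |s|`,
`p(s) − p(r) = −k`. -/
def IsDescendingKStair (n m : ℤ) (k : ℕ) (p : ℝ → ℝ → ℝ) : Prop :=
  IsKStair n m k p ∧
  ∀ r s : ℤ × ℤ, ConsecutiveStairs n m r s →
    r.1 ^ 2 + r.2 ^ 2 < s.1 ^ 2 + s.2 ^ 2 → p s.1 s.2 - p r.1 r.2 = -(k : ℝ)


lemma final_check : ∀ k ∈ Finset.Icc 4 11, ∀ q ∈ Finset.Icc 1 2, ∀ F ∈ Finset.range k,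
    ∀ u ∈ Finset.range k,
    ¬ ((∀ c ∈ Finset.range k, q * (c * (k - c)) ≤ 2 * F + 2 * (u * c % k)) ∧
      ∀ r ∈ Finset.range k, ∃ c ∈ Finset.range k,
        2 * r + q * (c * (k - c)) = 2 * F + 2 * (u * c % k)) := by
  set_option maxRecDepth 100000 in
  decide +kernel

lemma final_step (k q u : ℕ) (hk : 4 ≤ k) (hq : 1 ≤ q) (s : ℕ → ℕ)
    (hs : ∀ c < k, 2 * s c + q * (c * (k - c)) = 2 * s 0 + 2 * (u * c % k))
    (hsurj : ∀ r < k, ∃ c < k, s c = r) : False := by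
  have himg : Finset.range k ⊆ (Finset.range k).image s := by
    intro r hr
    obtain ⟨c, hc, h⟩ := hsurj r (Finset.mem_range.1 hr)
    exact Finset.mem_image.2 ⟨c, Finset.mem_range.2 hc, h⟩
  have heq := Finset.eq_of_subset_of_card_le himg Finset.card_image_le
  have hlt : ∀ c < k, s c < k := by
    intro c hc
    have : s c ∈ (Finset.range k).image s :=
      Finset.mem_image.2 ⟨c, Finset.mem_range.2 hc, rfl⟩
    rw [← heq] at this
    exact Finset.mem_range.1 this
  have hF := hlt 0 (by omega)
  have hsum : ∀ c, 0 < c → c < k → u * c % k + u * (k - c) % k ≤ k := by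
    intro c h0 hc
    have h1 : k ∣ u * c % k + u * (k - c) % k := by
      rw [Nat.dvd_iff_mod_eq_zero, ← Nat.add_mod, ← Nat.mul_add, Nat.add_sub_cancel' hc.le]
      simp
    have h2 := Nat.mod_lt (u * c) (show 0 < k by omega)
    have h3 := Nat.mod_lt (u * (k - c)) (show 0 < k by omega)
    obtain ⟨t, ht⟩ := h1
    have : t < 2 := by
      by_contra h
      nlinarith
    rw [ht]
    nlinarith
  have hb : q * ((k / 2) * (k - k / 2)) ≤ 3 * k - 2 := by
    have h1 := hs (k / 2) (by omega)
    have h2 := hs (k - k / 2) (by omega)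
    have h3 := hsum (k / 2) (by omega) (by omega)
    have h4 : k - (k - k / 2) = k / 2 := by omega
    rw [h4, Nat.mul_comm (k - k / 2)] at h2
    omega
  have hk11 : k ≤ 11 := by
    by_contra h
    have h6 : 6 ≤ k / 2 := by omega
    have h7 : k / 2 ≤ k - k / 2 := by omega
    have h8 : 1 * (6 * (k - k/2)) ≤ q * ((k / 2) * (k - k / 2)) := by gcongr
    omega
  have hq2 : q ≤ 2 := by
    by_contra h
    have h8 : 3 * (2 * (k - k/2)) ≤ q * ((k / 2) * (k - k / 2)) := by
      gcongr <;> omega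
    have h9 : 3 * ((k/2) * (k - k/2)) ≤ q * ((k / 2) * (k - k / 2)) := by
      gcongr; omega
    interval_cases k <;> omega
  refine final_check k (Finset.mem_Icc.2 ⟨hk, hk11⟩) q (Finset.mem_Icc.2 ⟨hq, hq2⟩) (s 0)
    (Finset.mem_range.2 hF) (u % k) (Finset.mem_range.2 (Nat.mod_lt _ (by omega))) ⟨?_, ?_⟩
  · intro c hc
    have := hs c (Finset.mem_range.1 hc)
    rw [Nat.mod_mul_mod]
    omega
  · intro r hr
    obtain ⟨c, hc, h⟩ := hsurj r (Finset.mem_range.1 hr)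
    refine ⟨c, Finset.mem_range.2 hc, ?_⟩
    have := hs c hc
    rw [Nat.mod_mul_mod, ← h]
    omega

lemma sum_shift (f : ℕ → ℝ) (a : ℕ) (hf : ∀ c, f (c + a) = f c) (k : ℕ) :
    ∑ c ∈ Finset.range a, f (c + k) = ∑ c ∈ Finset.range a, f c := by
  induction k with
  | zero => simp
  | succ k ih =>
    rw [← ih]
    have h1 := Finset.sum_range_succ (fun c => f (c + k)) a
    have h2 := Finset.sum_range_succ' (fun c => f (c + k)) a
    have h3 : f (a + k) = f (0 + k) := by rw [Nat.add_comm a k, hf]; simp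
    have h4 : ∀ c, f (c + (k + 1)) = f (c + 1 + k) := fun c => by congr 1; ring
    simp only [h4]
    linarith

lemma core (a q k β : ℕ) (ha : 1 ≤ a) (hq : 1 ≤ q) (hk : 4 ≤ k) (D F : ℝ) (s w : ℕ → ℕ)
    (hw : ∀ c, w c = q * c + if a ∣ c then 1 else 0)
    (hs : ∀ c, (s c : ℝ) = (q : ℝ) / 2 * (c : ℝ) ^ 2 + D * c + F
      + k * ((β * c % a : ℕ) : ℝ) / a)
    (hinj : ∀ c j c' j', j < w c → j' < w c' → s c + k * j = s c' + k * j' → c = c' ∧ j = j')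
    (hsurj : ∀ N, ∃ c j, j < w c ∧ s c + k * j = N) : False := by
  have haR : (0 : ℝ) < a := by exact_mod_cast ha
  have hkR : (4 : ℝ) ≤ k := by exact_mod_cast hk
  have hqR : (1 : ℝ) ≤ q := by exact_mod_cast hq
  have hwpos : ∀ c, 1 ≤ w c := by
    intro c
    rw [hw]
    rcases Nat.eq_zero_or_pos c with rfl | h
    · simp
    · have : 1 * 1 ≤ q * c := Nat.mul_le_mul hq h
      omega
  have hnext : ∀ c, ∃ c', s c' = s c + k * w c := by
    intro c
    obtain ⟨c', j, hj, h⟩ := hsurj (s c + k * w c)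
    rcases j with _ | j
    · exact ⟨c', by simpa using h⟩
    · exfalso
      have hwc := hwpos c
      obtain ⟨v, hv⟩ : ∃ v, w c = v + 1 := ⟨w c - 1, by omega⟩
      obtain ⟨h1, h2⟩ := hinj c' j c v (by omega) (by omega) (by
        rw [hv] at h
        simp only [Nat.mul_add] at h
        omega)
      subst h1
      omega
  set y : ℕ → ℕ := fun c => β * c % a with hy
  have hylt : ∀ c, y c < a := fun c => Nat.mod_lt _ (by omega)
  have hfr : ∀ c, (0:ℝ) ≤ k * (y c : ℝ) / a ∧ k * (y c : ℝ) / a ≤ k := by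
    intro c
    constructor
    · positivity
    · rw [div_le_iff₀ haR]
      have : (y c : ℝ) ≤ a := by exact_mod_cast (hylt c).le
      nlinarith
  have hwR : ∀ c, (w c : ℝ) = q * c + if a ∣ c then 1 else 0 := by
    intro c
    rw [hw]
    push_cast
    rfl
  obtain ⟨C, hC⟩ : ∃ C : ℕ, ∀ c ≥ C, s (c + k) = s c + k * w c := by
    obtain ⟨C, hC⟩ := exists_nat_gt (|(q : ℝ) * k ^ 2 + 2 * D * k| + 4 * k + 2 * |D|)
    refine ⟨C, fun c hc => ?_⟩
    obtain ⟨c', hc'⟩ := hnext c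
    have hcR : (C : ℝ) ≤ c := by exact_mod_cast hc
    have e : (s c' : ℝ) = s c + k * w c := by exact_mod_cast hc'
    rw [hs, hs, hwR] at e
    have f1 := hfr c
    have f2 := hfr c'
    simp only [hy] at f1 f2
    set A := (k : ℝ) * ((β * c % a : ℕ) : ℝ) / a
    set B := (k : ℝ) * ((β * c' % a : ℕ) : ℝ) / a
    obtain ⟨i, hi, hi0, hi1⟩ : ∃ i : ℝ, (if a ∣ c then (1 : ℝ) else 0) = i ∧ 0 ≤ i ∧ i ≤ 1 := by
      refine ⟨_, rfl, ?_, ?_⟩ <;> split_ifs <;> norm_num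
    rw [hi] at e
    have key : ((c' : ℝ) - c - k) * (q * (c + c' + k) + 2 * D)
        = -(q * k ^ 2 + 2 * D * k) + 2 * (A - B + k * i) := by
      linarith
    have hki0 : 0 ≤ k * i := by positivity
    have hki : k * i ≤ k := by nlinarith
    have hM : |((c' : ℝ) - c - k) * (q * (c + c' + k) + 2 * D)|
        ≤ |(q : ℝ) * k ^ 2 + 2 * D * k| + 4 * k := by
      rw [key]
      refine (abs_add_le _ _).trans ?_
      rw [abs_neg]
      have : |2 * (A - B + k * i)| ≤ 4 * k := by
        rw [abs_le]
        constructor <;> linarith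
      linarith
    have hbig : |(q : ℝ) * k ^ 2 + 2 * D * k| + 4 * k < q * (c + c' + k) + 2 * D := by
      have h1 := neg_abs_le D
      have h2 : (0:ℝ) ≤ c' := by positivity
      have h3 : (0:ℝ) ≤ c := by positivity
      nlinarith
    have hd : c' = c + k := by
      by_contra hne
      have hz : (1 : ℝ) ≤ |(c' : ℝ) - c - k| := by
        have : (1 : ℤ) ≤ |(c' : ℤ) - c - k| := by
          apply Int.one_le_abs
          intro h0
          apply hne
          omega
        exact_mod_cast this
      rw [abs_mul] at hM
      have h5 := le_abs_self ((q : ℝ) * (c + c' + k) + 2 * D)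
      have h6 := abs_nonneg ((q : ℝ) * (c + c' + k) + 2 * D)
      nlinarith
    rw [← hd, hc']
  have hyper : ∀ c t, y (c + a * t) = y c := by
    intro c t
    simp only [hy]
    rw [Nat.mul_add, Nat.mul_left_comm, Nat.add_mul_mod_self_left]
  have hrel : ∀ c, ((y (c + k) : ℝ) - y c) / a
      = (if a ∣ c then (1:ℝ) else 0) - (q * k / 2 + D) := by
    intro c
    have h1 := hC (c + a * C) (by nlinarith)
    have h2 : (s (c + a * C + k) : ℝ) = s (c + a * C) + k * w (c + a * C) := by
      exact_mod_cast h1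
    have h3 := hyper c C
    have h4 := hyper (c + k) C
    rw [show c + k + a * C = c + a * C + k by ring] at h4
    simp only [hy] at h3 h4
    rw [hs, hs, hwR, h3, h4] at h2
    have h5 : (a ∣ c + a * C) ↔ a ∣ c := by
      exact (Nat.dvd_add_left (Dvd.intro _ rfl))
    simp only [h5] at h2
    have hk0 : (k:ℝ) ≠ 0 := by positivity
    apply mul_left_cancel₀ hk0
    simp only [hy]
    push_cast at h2 ⊢
    generalize (if a ∣ c then (1 : ℝ) else 0) = i at *
    have : (k:ℝ) * (((β * (c + k) % a : ℕ) : ℝ) - (β * c % a : ℕ)) / a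
      = k * ((β * (c + k) % a : ℕ) : ℝ) / a - k * ((β * c % a : ℕ) : ℝ) / a := by ring
    rw [← mul_div_assoc, this]
    linarith
  have hD : a * (q * k / 2 + D) = 1 := by
    have h1 := sum_shift (fun c => (y c : ℝ) / a) a (fun c => by
      have := hyper c 1
      simp only [Nat.mul_one] at this
      simp only [this]) k
    have h2 : ∑ c ∈ Finset.range a, (((y (c + k) : ℝ) - y c) / a) = 0 := by
      simp only [sub_div, Finset.sum_sub_distrib]
      linarith
    simp only [hrel, Finset.sum_sub_distrib] at h2
    have h3 : ∑ c ∈ Finset.range a, (if a ∣ c then (1:ℝ) else 0) = 1 := by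
      rw [Finset.sum_eq_single 0]
      · simp
      · intro c hc h0
        rw [if_neg]
        intro hd
        have := Nat.le_of_dvd (by omega) hd
        have := Finset.mem_range.1 hc
        omega
      · intro h
        exact absurd (Finset.mem_range.2 (by omega)) h
    rw [h3] at h2
    simp only [Finset.sum_const, Finset.card_range, nsmul_eq_mul] at h2
    linarith
  have hD' : D = 1 / a - q * k / 2 := by
    field_simp
    linarith
  have hall : ∀ c, s (c + k) = s c + k * w c := by
    intro c
    have h := hrel c
    have : (s (c + k) : ℝ) = s c + k * w c := by
      rw [hs, hs, hwR]
      simp only [hy] at h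
      generalize (if a ∣ c then (1 : ℝ) else 0) = i at *
      have h' : k * ((β * (c + k) % a : ℕ) : ℝ) / a
        = k * ((β * c % a : ℕ) : ℝ) / a + k * (i - (q * k / 2 + D)) := by
        rw [← h]; ring
      rw [h']
      push_cast
      ring
    exact_mod_cast this
  have hyk : y k + 1 = a := by
    have h := hrel 0
    have h0 : y 0 = 0 := by simp [hy]
    rw [h0] at h
    simp only [Nat.zero_add, dvd_zero, if_true, Nat.cast_zero, sub_zero] at h
    rw [div_eq_iff haR.ne'] at h
    have : (y k : ℝ) + 1 = a := by rw [h]; linarith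
    exact_mod_cast this
  have hβ : a ∣ β * k + 1 := by
    have h1 := Nat.mod_add_div (β * k) a
    simp only [hy] at hyk
    refine ⟨β * k / a + 1, ?_⟩
    rw [Nat.mul_add]
    omega
  have hh : ∀ c, ∃ h, a * h = c + k * y c := by
    intro c
    have : a ∣ c + k * y c := by
      have h1 : a ∣ c + k * (β * c) := by
        have := Dvd.dvd.mul_right hβ c
        rwa [show (β * k + 1) * c = c + k * (β * c) by ring] at this
      have h2 := Nat.mod_add_div (β * c) a
      have h3 : c + k * (β * c) = (c + k * y c) + a * (k * (β * c / a)) := by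
        simp only [hy]
        conv_lhs => rw [← h2]
        ring
      rw [h3] at h1
      exact (Nat.dvd_add_left (Dvd.intro _ rfl)).1 h1
    obtain ⟨h, e⟩ := this
    exact ⟨h, e.symm⟩
  choose h hh using hh
  have hhlt : ∀ c < k, h c < k := by
    intro c hc
    have h1 := hh c
    have h2 := hylt c
    by_contra hcon
    have h3 : a * k ≤ a * h c := Nat.mul_le_mul_left _ (by omega)
    have h4 : k * (y c + 1) ≤ k * a := Nat.mul_le_mul_left _ h2
    nlinarith
  have hmod : ∀ c < k, h c = h 1 * c % k := by
    intro c hc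
    have hcop : Nat.gcd k a = 1 := by
      have hd1 : Nat.gcd k a ∣ β * k + 1 := (Nat.gcd_dvd_right k a).trans hβ
      have hd2 : Nat.gcd k a ∣ β * k := (Nat.gcd_dvd_left k a).trans (Dvd.intro_left _ rfl)
      exact Nat.dvd_one.1 ((Nat.dvd_add_right hd2).1 hd1)
    have h1 : a * h c ≡ a * (h 1 * c) [MOD k] := by
      have e1 : a * h c ≡ c [MOD k] := by
        rw [hh c]
        simp [Nat.ModEq]
      have e2 : a * (h 1 * c) ≡ c [MOD k] := by
        rw [← Nat.mul_assoc, hh 1, Nat.add_mul, Nat.one_mul, Nat.mul_assoc]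
        simp [Nat.ModEq]
      exact e1.trans e2.symm
    have h2 := Nat.ModEq.cancel_left_of_coprime hcop h1
    have h3 : h c % k = h 1 * c % k := h2
    rwa [Nat.mod_eq_of_lt (hhlt c hc)] at h3
  refine final_step k q (h 1) hk hq s ?_ ?_
  · intro c hc
    rw [← hmod c hc]
    have e0 := hs 0
    have e1 := hs c
    simp only [Nat.zero_mod, Nat.cast_zero, mul_zero, zero_div, add_zero] at e0
    have e2 : (a : ℝ) * h c = c + k * (β * c % a : ℕ) := by exact_mod_cast hh c
    have e3 : (h c : ℝ) = c / a + k * ((β * c % a : ℕ) : ℝ) / a := by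
      field_simp
      linarith
    have : (2 * s c + q * (c * (k - c)) : ℝ) = 2 * s 0 + 2 * h c := by
      rw [e3, e1, e0, hD']
      ring
    rw [← Nat.cast_sub hc.le] at this
    exact_mod_cast this
  · intro r hr
    obtain ⟨c, j, hj, e⟩ := hsurj r
    have hj0 : j = 0 := by
      by_contra hne
      have : k * 1 ≤ k * j := Nat.mul_le_mul_left _ (by omega)
      omega
    subst hj0
    refine ⟨c, ?_, by simpa using e⟩
    by_contra hck
    have h1 := hall (c - k)
    rw [Nat.sub_add_cancel (by omega)] at h1
    have : k * 1 ≤ k * w (c - k) := Nat.mul_le_mul_left _ (hwpos _)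
    omega

lemma mid (a q k β : ℕ) (ha : 1 ≤ a) (hq : 1 ≤ q) (hk : 4 ≤ k) (hco : Nat.Coprime a β)
    (D F : ℝ) (G : ℕ → ℕ → ℝ)
    (hG : ∀ c z, G c z = (q : ℝ) / 2 * (c : ℝ) ^ 2 + D * c + F + k * (z : ℝ) / a)
    (hN : ∀ c z : ℕ, z ≤ a * q * c → z ≡ β * c [MOD a] → ∃ j : ℕ, G c z = j)
    (hinj : ∀ c z c' z' : ℕ, z ≤ a * q * c → z ≡ β * c [MOD a] → z' ≤ a * q * c' →
      z' ≡ β * c' [MOD a] → G c z = G c' z' → c = c' ∧ z = z')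
    (hsurj : ∀ N : ℕ, ∃ c z : ℕ, z ≤ a * q * c ∧ z ≡ β * c [MOD a] ∧ G c z = N) : False := by
  have haR : (0 : ℝ) < a := by exact_mod_cast ha
  have hiff : ∀ c, a ∣ c ↔ β * c % a = 0 := by
    intro c
    rw [← Nat.dvd_iff_mod_eq_zero, hco.dvd_mul_left]
  have hlt : ∀ c, β * c % a < a := fun c => Nat.mod_lt _ (by omega)
  have hin : ∀ c j, (β * c % a + a * j ≤ a * q * c) ↔
      j < q * c + if a ∣ c then 1 else 0 := by
    intro c j
    have h1 := hlt c
    rw [Nat.mul_assoc]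
    by_cases hd : a ∣ c
    · rw [if_pos hd, (hiff c).1 hd, Nat.zero_add, Nat.lt_succ_iff]
      exact ⟨fun h => Nat.le_of_mul_le_mul_left h (by omega), fun h => Nat.mul_le_mul_left _ h⟩
    · rw [if_neg hd, Nat.add_zero]
      have h2 : β * c % a ≠ 0 := fun h => hd ((hiff c).2 h)
      constructor
      · intro h
        by_contra hc
        have : a * (q * c) ≤ a * j := Nat.mul_le_mul_left _ (by omega)
        omega
      · intro h
        have : a * (j + 1) ≤ a * (q * c) := Nat.mul_le_mul_left _ (by omega)
        rw [Nat.mul_add] at this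
        omega
  have hmodeq : ∀ c j, β * c % a + a * j ≡ β * c [MOD a] := by
    intro c j
    simp [Nat.ModEq]
  have hwpos : ∀ c, 0 < q * c + if a ∣ c then 1 else 0 := by
    intro c
    rcases Nat.eq_zero_or_pos c with rfl | h
    · simp
    · have : 1 * 1 ≤ q * c := Nat.mul_le_mul hq h
      omega
  have hex : ∀ c, ∃ j : ℕ, G c (β * c % a) = j := by
    intro c
    have h1 := (hin c 0).2 (hwpos c)
    have h2 := hmodeq c 0
    simp only [Nat.mul_zero, Nat.add_zero] at h1 h2
    exact hN c _ h1 h2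
  choose s hs using hex
  have hGs : ∀ c j, G c (β * c % a + a * j) = ((s c + k * j : ℕ) : ℝ) := by
    intro c j
    push_cast
    rw [← hs, hG, hG]
    push_cast
    field_simp
    ring
  refine core a q k β ha hq hk D F s (fun c => q * c + if a ∣ c then 1 else 0)
    (fun c => rfl) (fun c => by rw [← hs, hG]) ?_ ?_
  · intro c j c' j' hj hj' e
    obtain ⟨h1, h2⟩ := hinj c _ c' _ ((hin c j).2 hj) (hmodeq c j) ((hin c' j').2 hj')
      (hmodeq c' j') (by rw [hGs, hGs, e])
    refine ⟨h1, ?_⟩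
    subst h1
    exact Nat.eq_of_mul_eq_mul_left (by omega) (Nat.add_left_cancel h2)
  · intro N
    obtain ⟨c, z, hz, hm, e⟩ := hsurj N
    have hz' : z = β * c % a + a * (z / a) := by
      have := Nat.mod_add_div z a
      have hm' : z % a = β * c % a := hm
      omega
    rw [hz'] at hz e
    refine ⟨c, z / a, (hin c _).1 hz, ?_⟩
    rw [hGs] at e
    exact_mod_cast e


lemma mid2 (a b q k : ℕ) (ha : 1 ≤ a) (hq : 1 ≤ q) (hk : 4 ≤ k) (hab : Nat.Coprime a b)
    (D F σ : ℝ) (hσ : σ = k ∨ σ = -(k : ℝ)) (V : ℕ → ℕ → ℝ)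
    (hV : ∀ c y, V c y = (q : ℝ) / 2 * (c : ℝ) ^ 2 + D * c + F + σ * (y : ℝ) / a)
    (hN : ∀ c y : ℕ, y ≤ a * q * c → a ∣ c + b * y → ∃ j : ℕ, V c y = j)
    (hinj : ∀ c y c' y' : ℕ, y ≤ a * q * c → a ∣ c + b * y → y' ≤ a * q * c' →
      a ∣ c' + b * y' → V c y = V c' y' → c = c' ∧ y = y')
    (hsurj : ∀ N : ℕ, ∃ c y : ℕ, y ≤ a * q * c ∧ a ∣ c + b * y ∧ V c y = N) : False := by
  have haR : (0 : ℝ) < a := by exact_mod_cast ha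
  have haZ : (0 : ℤ) < a := by exact_mod_cast ha
  have hcop : IsCoprime (a : ℤ) (b : ℤ) := Nat.isCoprime_iff_coprime.2 hab
  -- inverse of `b` modulo `a`, with any prescribed sign
  have hinv : ∀ ε : ℤ, ∃ β : ℕ, (a : ℤ) ∣ b * β - ε := by
    intro ε
    obtain ⟨u, v, huv⟩ := hcop
    obtain ⟨β, hβ⟩ := Int.eq_ofNat_of_zero_le (Int.emod_nonneg (ε * v) haZ.ne')
    refine ⟨β, ?_⟩
    have h1 := Int.emod_add_mul_ediv (ε * v) a
    rw [hβ] at h1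
    refine ⟨- ε * u - b * (ε * v / a), ?_⟩
    have h2 : (β : ℤ) = ε * v - a * (ε * v / a) := by
      linarith
    rw [h2]
    linear_combination ε * huv
  have hβco : ∀ (ε : ℤ) (β : ℕ), ε * ε = 1 → (a : ℤ) ∣ b * β - ε → Nat.Coprime a β := by
    rintro ε β hε ⟨t, ht⟩
    apply Nat.isCoprime_iff_coprime.1
    refine ⟨-ε * t, ε * b, ?_⟩
    linear_combination ε * ht + hε
  have hmod : ∀ z w : ℕ, z ≡ w [MOD a] ↔ (a : ℤ) ∣ z - w := by
    intro z w
    rw [Nat.modEq_iff_dvd, ← dvd_neg, neg_sub]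
  rcases hσ with rfl | rfl
  · obtain ⟨β, hβ⟩ := hinv (-1)
    have hiff : ∀ c z : ℕ, z ≡ β * c [MOD a] ↔ a ∣ c + b * z := by
      intro c z
      rw [hmod, ← Int.natCast_dvd_natCast]
      push_cast
      have h1 : (c : ℤ) + b * z = b * (z - β * c) + (b * β - -1) * c := by ring
      rw [h1, dvd_add_left (Dvd.dvd.mul_right hβ _)]
      exact ⟨fun h => Dvd.dvd.mul_left h _, fun h => hcop.dvd_of_dvd_mul_left h⟩
    refine mid a q k β ha hq hk (hβco _ β (by norm_num) hβ) D F V hV ?_ ?_ ?_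
    · intro c z h1 h2
      exact hN c z h1 ((hiff c z).1 h2)
    · intro c z c' z' h1 h2 h3 h4
      exact hinj c z c' z' h1 ((hiff c z).1 h2) h3 ((hiff c' z').1 h4)
    · intro N
      obtain ⟨c, z, h1, h2, h3⟩ := hsurj N
      exact ⟨c, z, h1, (hiff c z).2 h2, h3⟩
  · obtain ⟨β, hβ⟩ := hinv 1
    have hiff : ∀ c z y : ℕ, z + y = a * q * c → (z ≡ β * c [MOD a] ↔ a ∣ c + b * y) := by
      intro c z y hzy
      rw [hmod, ← Int.natCast_dvd_natCast]
      push_cast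
      have h0 : (z : ℤ) + y = a * q * c := by exact_mod_cast hzy
      have h1 : (c : ℤ) + b * y = -(b * (z - β * c)) + (a * (b * q * c) - (b * β - 1) * c) := by
        linear_combination b * h0
      rw [h1, dvd_add_left (dvd_sub (Dvd.intro _ rfl) (Dvd.dvd.mul_right hβ _)), dvd_neg]
      exact ⟨fun h => Dvd.dvd.mul_left h _, fun h => hcop.dvd_of_dvd_mul_left h⟩
    have hval : ∀ c z y : ℕ, z + y = a * q * c → V c y
        = (q : ℝ) / 2 * (c : ℝ) ^ 2 + (D - k * q) * c + F + k * (z : ℝ) / a := by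
      intro c z y hzy
      have h0 : (z : ℝ) + y = a * q * c := by exact_mod_cast hzy
      have h1 : (y : ℝ) = a * q * c - z := by linarith
      rw [hV, h1]
      field_simp
      ring
    refine mid a q k β ha hq hk (hβco _ β (by norm_num) hβ) (D - k * q) F _ (fun c z => rfl)
      ?_ ?_ ?_
    · intro c z h1 h2
      have hz : z + (a * q * c - z) = a * q * c := by omega
      obtain ⟨j, hj⟩ := hN c (a * q * c - z) (by omega) ((hiff c z _ hz).1 h2)
      exact ⟨j, by rw [← hj, hval c z _ hz]⟩
    · intro c z c' z' h1 h2 h3 h4 h5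
      have hz : z + (a * q * c - z) = a * q * c := by omega
      have hz' : z' + (a * q * c' - z') = a * q * c' := by omega
      obtain ⟨e1, e2⟩ := hinj c (a * q * c - z) c' (a * q * c' - z') (by omega)
        ((hiff c z _ hz).1 h2) (by omega) ((hiff c' z' _ hz').1 h4)
        (by rw [hval c z _ hz, hval c' z' _ hz']; exact h5)
      subst e1
      exact ⟨rfl, by omega⟩
    · intro N
      obtain ⟨c, y, h1, h2, h3⟩ := hsurj N
      have hz : (a * q * c - y) + y = a * q * c := by omega
      exact ⟨c, a * q * c - y, by omega, (hiff c _ y hz).2 h2, by rw [← h3, hval c _ y hz]⟩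

/-- For coprime positive integers `n`, `m` with `m ≥ 2`, `n/m > 1`, and
`n ∣ (m−1)²`, and every `k ≥ 4`, there is no `k`-stair packing polynomial on `S(n/m)`. -/
theorem no_k_stair_ge_four (n m : ℕ) (hn : 0 < n) (hm : 2 ≤ m) (hnm : m < n)
    (hco : Nat.Coprime n m) (hdvd : n ∣ (m - 1) ^ 2) :
    ∀ k : ℕ, 4 ≤ k →
      ¬ ∃ p : ℝ → ℝ → ℝ, IsKStair (n : ℤ) (m : ℤ) k p ∧
          IsPackingPolyOn p (sectorLattice (n : ℤ) (m : ℤ)) := by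
  rintro k hk ⟨p, ⟨⟨d, e, f, hp⟩, -, hstair⟩, hN, hinj, hsurj⟩
  -- arithmetic set-up
  obtain ⟨M, rfl⟩ : ∃ M, m = M + 1 := ⟨m - 1, by omega⟩
  simp only [Nat.add_sub_cancel] at hdvd
  have hg : Int.gcd ((n : ℕ) : ℤ) (((M + 1 : ℕ) : ℤ) - 1) = Nat.gcd n M := by
    rw [show (((M + 1 : ℕ) : ℤ) - 1) = ((M : ℕ) : ℤ) by push_cast; ring]
    exact Int.gcd_natCast_natCast n M
  obtain ⟨l, hl⟩ : ∃ l, l = Nat.gcd n M := ⟨_, rfl⟩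
  have hlpos : 0 < l := by rw [hl]; exact Nat.gcd_pos_of_pos_left _ hn
  obtain ⟨a, ha⟩ : l ∣ n := by rw [hl]; exact Nat.gcd_dvd_left _ _
  obtain ⟨b, hb⟩ : l ∣ M := by rw [hl]; exact Nat.gcd_dvd_right _ _
  have hab : Nat.Coprime a b := by
    have : l * Nat.gcd a b = l * 1 := by
      rw [← Nat.gcd_mul_left, ← ha, ← hb, ← hl, Nat.mul_one]
    exact Nat.eq_of_mul_eq_mul_left hlpos this
  obtain ⟨q, hq⟩ : a ∣ l := by
    rw [ha, hb] at hdvd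
    have h1 : l * a ∣ l * (l * b ^ 2) := by
      rwa [show (l * b) ^ 2 = l * (l * b ^ 2) by ring] at hdvd
    have h2 := Nat.dvd_of_mul_dvd_mul_left hlpos h1
    exact (Nat.Coprime.pow_right 2 hab).dvd_of_dvd_mul_right h2
  have hapos : 0 < a := Nat.pos_of_ne_zero (by rintro rfl; simp at ha; omega)
  have hbpos : 0 < b := Nat.pos_of_ne_zero (by rintro rfl; simp at hb; omega)
  have hqpos : 0 < q := Nat.pos_of_ne_zero (by rintro rfl; simp at hq; omega)
  have hnZ : (n : ℤ) = a * q * a := by rw [ha, hq]; push_cast; ring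
  have hMZ : (M : ℤ) = a * q * b := by rw [hb, hq]; push_cast; ring
  have hnR : (n : ℝ) = a * q * a := by exact_mod_cast hnZ
  have hMR : (M : ℝ) = a * q * b := by exact_mod_cast hMZ
  have haR : (0 : ℝ) < a := by exact_mod_cast hapos
  have hqR : (0 : ℝ) < q := by exact_mod_cast hqpos
  have haZ : (0 : ℤ) < a := by exact_mod_cast hapos
  have hbZ : (0 : ℤ) < b := by exact_mod_cast hbpos
  have hqZ : (0 : ℤ) < q := by exact_mod_cast hqpos
  have hlZ : (l : ℤ) = a * q := by exact_mod_cast hq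
  have hval : ∀ x y : ℝ, p x y = (q : ℝ) / 2 * (a * x - b * y) ^ 2 + d / a * (a * x - b * y)
      + f + (d * b + e * a) * y / a := by
    intro x y
    rw [hp]
    push_cast
    rw [hnR, hMR]
    field_simp
    ring
  have hsec : ∀ x y : ℤ, (x, y) ∈ sectorLattice (n : ℤ) ((M + 1 : ℕ) : ℤ) ↔
      0 ≤ y ∧ y ≤ a * q * (a * x - b * y) := by
    intro x y
    simp only [sectorLattice, Set.mem_ofPred_eq]
    push_cast
    rw [hnZ, hMZ]
    constructor
    · rintro ⟨h1, h2, h3⟩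
      exact ⟨h2, by linarith⟩
    · rintro ⟨h1, h2⟩
      have h3 : 0 ≤ (a : ℤ) * x - b * y := by
        by_contra h
        have : (0:ℤ) < a * q := by positivity
        nlinarith
      refine ⟨?_, h1, by linarith⟩
      by_contra h
      have h4 : (0:ℤ) ≤ b * y := by positivity
      nlinarith
  -- the step along a staircase
  have hσ : d * b + e * a = k ∨ d * b + e * a = -(k : ℝ) := by
    have hcs : ConsecutiveStairs (n : ℤ) ((M + 1 : ℕ) : ℤ) (1, 0) (1 + b, a) := by
      refine ⟨a, ?_, ?_, ?_, ?_⟩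
      · refine ⟨(hsec _ _).2 ⟨le_rfl, by simp; positivity⟩, ?_⟩
        rw [hg, ← hl, hlZ, hnZ]
        push_cast
        ring
      · refine ⟨(hsec _ _).2 ⟨haZ.le, ?_⟩, ?_⟩
        · have h1 : (1:ℤ) ≤ q * a := by
            have : (0:ℤ) < q * a := by positivity
            omega
          nlinarith
        · rw [hg, ← hl, hlZ, hnZ]
          push_cast
          rw [hMZ]
          ring
      · intro h
        have := congrArg Prod.fst h
        simp at this
        omega
      · rintro ⟨t1, t2⟩ ⟨-, ht⟩ ⟨h1, h2⟩
        rw [hg, ← hl, hlZ, hnZ] at ht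
        push_cast at ht
        rw [hMZ] at ht
        simp only at h1 h2 ht
        rw [min_eq_left (by omega)] at h1
        rw [max_eq_right (by omega)] at h2
        have h3 : (b : ℤ) * t2 = a * (t1 - 1) := by
          have h0 : (a : ℤ) * q ≠ 0 := by positivity
          apply mul_left_cancel₀ h0
          linarith
        have h4 : (b : ℤ) ∣ t1 - 1 := by
          have hcop : IsCoprime (b : ℤ) (a : ℤ) := Nat.isCoprime_iff_coprime.2 hab.symm
          exact hcop.dvd_of_dvd_mul_left (Dvd.intro _ h3)
        have := Int.le_of_dvd (by omega) h4
        omega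
    have h := hstair _ _ hcs
    rw [hval, hval] at h
    push_cast at h
    have h5 : (d * b + e * a) * (a : ℝ) / a = d * b + e * a := by field_simp
    have h6 : (a : ℝ) * (1 + b) - b * a = a := by ring
    have h7 : (a : ℝ) * 1 - b * 0 = a := by ring
    rw [h5, h6, h7, mul_zero, zero_div] at h
    rcases h with h | h
    · right
      linarith
    · left
      linarith
  have hpt : ∀ c y x : ℕ, a * x = c + b * y → (a : ℤ) * x - b * y = c := by
    intro c y x h
    have : (a : ℤ) * x = c + b * y := by exact_mod_cast h
    linarith
  have hptR : ∀ c y x : ℕ, a * x = c + b * y → (a : ℝ) * x - b * y = c := by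
    intro c y x h
    have := hpt c y x h
    exact_mod_cast this
  have hmem : ∀ c y x : ℕ, y ≤ a * q * c → a * x = c + b * y →
      ((x : ℤ), (y : ℤ)) ∈ sectorLattice (n : ℤ) ((M + 1 : ℕ) : ℤ) := by
    intro c y x hy hx
    rw [hsec, hpt c y x hx]
    exact ⟨by positivity, by exact_mod_cast hy⟩
  have hpv : ∀ c y x : ℕ, a * x = c + b * y → p ((x : ℤ) : ℝ) ((y : ℤ) : ℝ)
      = (q : ℝ) / 2 * (c : ℝ) ^ 2 + d / a * c + f + (d * b + e * a) * y / a := by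
    intro c y x hx
    rw [hval]
    push_cast
    rw [hptR c y x hx]
  refine mid2 a b q k hapos hqpos hk hab (d / a) f (d * b + e * a) hσ _ (fun c y => rfl)
    ?_ ?_ ?_
  · rintro c y hy ⟨x, hx⟩
    obtain ⟨j, hj⟩ := hN _ (hmem c y x hy hx.symm)
    exact ⟨j, by rw [← hj, hpv c y x hx.symm]⟩
  · rintro c y c' y' hy ⟨x, hx⟩ hy' ⟨x', hx'⟩ h
    have h1 := hinj (hmem c y x hy hx.symm) (hmem c' y' x' hy' hx'.symm) (by
      simp only
      rw [hpv c y x hx.symm, hpv c' y' x' hx'.symm]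
      exact h)
    have e1 : x = x' := by exact Int.ofNat.inj (congrArg Prod.fst h1)
    have e2 : y = y' := by exact Int.ofNat.inj (congrArg Prod.snd h1)
    subst e1 e2
    exact ⟨by omega, rfl⟩
  · intro N
    obtain ⟨⟨x, y⟩, hP, hv⟩ := hsurj N
    have h1 := (hsec x y).1 hP
    have hx0 : 0 ≤ x := hP.1
    obtain ⟨x, rfl⟩ := Int.eq_ofNat_of_zero_le hx0
    obtain ⟨y, rfl⟩ := Int.eq_ofNat_of_zero_le h1.1
    have h3 : 0 ≤ (a : ℤ) * x - b * y := by
      by_contra h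
      have : (0:ℤ) < a * q := by positivity
      nlinarith [h1.1, h1.2]
    obtain ⟨c, hc⟩ := Int.eq_ofNat_of_zero_le h3
    have hx : a * x = c + b * y := by
      zify
      linarith
    refine ⟨c, y, ?_, ⟨x, hx.symm⟩, ?_⟩
    · have := h1.2
      rw [hc] at this
      exact_mod_cast this
    · rw [← hv]
      exact (hpv c y x hx).symm
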